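/- Suppose Ω ⊂ ℝ^d is a domain, B = B(x,r) is a ball centered at x ∈ ∂Ω, ∂Ω ∩ B ∈ Lip(τ), and τ < 1/4. Fix coordinates so that the isometry in the definition of Lip(τ) is the identity and let e_d be the unit vector in the last coordinate direction. Let x₀ ∈ closure(Ω) ∩ B(x, r/4) and x₁ = x₀ + τ r e_d. Then Ω ∩ B(x₁, r/2) is star-shaped with respect to x₁, i.e. for every x₂ ∈ Ω ∩ B(x₁, r/2) the open segment from x₁ to x₂ is contained in Ω ∩ B(x₁, r/2). -/

import Mathlib

open Metric MeasureTheory Set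
open scoped ENNReal NNReal

noncomputable section

/-- `Euc m` is the Euclidean space `ℝ^(m+1)`. -/
abbrev Euc (m : ℕ) : Type := EuclideanSpace ℝ (Fin (m + 1))

/-- The first `m` coordinates of a point of `ℝ^(m+1)`. -/
def front {m : ℕ} (y : Euc m) : EuclideanSpace ℝ (Fin m) :=
  (WithLp.equiv 2 (∀ _ : Fin m, ℝ)).symm fun i : Fin m => y i.castSucc

/-- The last coordinate of a point of `ℝ^(m+1)`. -/
def lastC {m : ℕ} (y : Euc m) : ℝ := y (Fin.last m)

/-- The unit vector of `ℝ^(m+1)` in the last coordinate direction. -/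
def eLast (m : ℕ) : Euc m := EuclideanSpace.single (Fin.last m) 1

/-- The point `(x', 0) ∈ ℝ^(m+1)` determined by `x' ∈ ℝ^m`. -/
def pad {m : ℕ} (x' : EuclideanSpace ℝ (Fin m)) : Euc m :=
  (WithLp.equiv 2 (∀ _ : Fin (m + 1), ℝ)).symm
    (Fin.snoc (WithLp.equiv 2 (∀ _ : Fin m, ℝ) x') 0)

/-- The Laplacian of `h : ℝ^d → ℝ` at `x`: the sum of the pure second derivatives in the
coordinate directions. -/
def lap {d : ℕ} (h : EuclideanSpace ℝ (Fin d) → ℝ) (x : EuclideanSpace ℝ (Fin d)) : ℝ :=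
  ∑ i : Fin d, iteratedFDeriv ℝ 2 h x ![EuclideanSpace.single i 1, EuclideanSpace.single i 1]

/-- `h` is harmonic on `Ω`: it is twice continuously differentiable there and its
Laplacian vanishes. -/
def IsHarmonicOn {d : ℕ} (h : EuclideanSpace ℝ (Fin d) → ℝ)
    (Ω : Set (EuclideanSpace ℝ (Fin d))) : Prop :=
  ContDiffOn ℝ 2 h Ω ∧ ∀ x ∈ Ω, lap h x = 0

/-- `H_h(x,r) = ∫_{B(x,r) ∩ Ω} h²`. -/
def Hh {d : ℕ} (Ω : Set (EuclideanSpace ℝ (Fin d))) (h : EuclideanSpace ℝ (Fin d) → ℝ)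
    (x : EuclideanSpace ℝ (Fin d)) (r : ℝ) : ℝ :=
  ∫ y in ball x r ∩ Ω, (h y) ^ 2

/-- The doubling index `N_h(x,r) = log (H_h(x,2r) / H_h(x,r))`. -/
def Nh {d : ℕ} (Ω : Set (EuclideanSpace ℝ (Fin d))) (h : EuclideanSpace ℝ (Fin d) → ℝ)
    (x : EuclideanSpace ℝ (Fin d)) (r : ℝ) : ℝ :=
  Real.log (Hh Ω h x (2 * r) / Hh Ω h x r)

/-- `∂Ω ∩ B(x,r) ∈ Lip(τ)`: in suitable isometric coordinates centered at `x`, `Ω ∩ B(x,r)`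
is the region above the graph of a `τ`-Lipschitz function `f` with `f 0 = 0`. -/
def LipGraph {m : ℕ} (Ω : Set (Euc m)) (τ : ℝ≥0) (x : Euc m) (r : ℝ) : Prop :=
  ∃ T : Euc m ≃ᵢ Euc m, ∃ f : EuclideanSpace ℝ (Fin m) → ℝ,
    T 0 = x ∧ LipschitzOnWith τ f (ball 0 r) ∧ f 0 = 0 ∧
    Ω ∩ ball x r = T '' {y : Euc m | y ∈ ball (0 : Euc m) r ∧ f (front y) < lastC y}

/-- `∂Ω ∩ B(x,r)` is a `C^k`-smooth graph: same as `LipGraph` but with a `C^k` function. -/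
def SmoothGraph {m : ℕ} (k : ℕ) (Ω : Set (Euc m)) (x : Euc m) (r : ℝ) : Prop :=
  ∃ T : Euc m ≃ᵢ Euc m, ∃ f : EuclideanSpace ℝ (Fin m) → ℝ,
    T 0 = x ∧ ContDiffOn ℝ k f (ball 0 r) ∧ f 0 = 0 ∧
    Ω ∩ ball x r = T '' {y : Euc m | y ∈ ball (0 : Euc m) r ∧ f (front y) < lastC y}

/-- The closed axis-parallel cube with center `p` and side length `s`. -/
def cube {d : ℕ} (p : EuclideanSpace ℝ (Fin d)) (s : ℝ) : Set (EuclideanSpace ℝ (Fin d)) :=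
  {y | ∀ i, |y i - p i| ≤ s / 2}

/-- The maximal doubling index `N*_h(Q)` of `h` in the cube `Q`. -/
def Nstar {d : ℕ} (Ω : Set (EuclideanSpace ℝ (Fin d))) (h : EuclideanSpace ℝ (Fin d) → ℝ)
    (Q : Set (EuclideanSpace ℝ (Fin d))) : ℝ :=
  sSup {N : ℝ | ∃ x ∈ Q ∩ closure Ω, ∃ r : ℝ,
    Metric.diam Q / 2 ≤ r ∧ r ≤ Metric.diam Q ∧ N = Nh Ω h x r}

/-- Centers of the boundary cubes `q ∈ B_k(Q)` of the standard construction: `z` lies on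
`∂Ω ∩ Q` and its horizontal projection is the center of one of the `2^(k·m)` congruent
subcubes of side `s/2^k` partitioning the projection of `Q`. -/
def bCenters {m : ℕ} (Ω : Set (Euc m)) (xQ : Euc m) (s : ℝ) (k : ℕ) : Set (Euc m) :=
  {z | z ∈ frontier Ω ∩ cube xQ s ∧
    ∃ j : Fin m → Fin (2 ^ k), ∀ i : Fin m,
      front z i = front xQ i - s / 2 + (s / 2 ^ k) * ((j i : ℝ) + 1 / 2)}

theorem front_add {m : ℕ} (x y : Euc m) : front (x + y) = front x + front y := by
  ext i
  simp [front]

theorem front_smul {m : ℕ} (c : ℝ) (x : Euc m) : front (c • x) = c • front x := by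
  ext i
  simp [front]

theorem front_sub {m : ℕ} (x y : Euc m) : front (x - y) = front x - front y := by
  ext i
  simp [front]

theorem lastC_add {m : ℕ} (x y : Euc m) : lastC (x + y) = lastC x + lastC y := by
  simp [lastC]

theorem lastC_smul {m : ℕ} (c : ℝ) (x : Euc m) : lastC (c • x) = c * lastC x := by
  simp [lastC]

theorem front_eLast (m : ℕ) : front (eLast m) = 0 := by
  ext i
  simp [front, eLast]

theorem lastC_eLast (m : ℕ) : lastC (eLast m) = 1 := by
  simp [lastC, eLast]

theorem norm_front_le {m : ℕ} (x : Euc m) : ‖front x‖ ≤ ‖x‖ := by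
  rw [EuclideanSpace.norm_eq, EuclideanSpace.norm_eq, Fin.sum_univ_castSucc]
  exact Real.sqrt_le_sqrt (le_add_of_nonneg_right (sq_nonneg _))

theorem front_mem_ball {m : ℕ} {x : Euc m} {r : ℝ} (hx : x ∈ ball 0 r) :
    front x ∈ ball 0 r := by
  rw [mem_ball_zero_iff] at hx ⊢
  exact (norm_front_le x).trans_lt hx

theorem continuous_front {m : ℕ} : Continuous (front : Euc m → EuclideanSpace ℝ (Fin m)) := by
  refine (PiLp.continuous_toLp 2 _).comp (continuous_pi fun i => ?_)
  fun_prop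

theorem continuous_lastC {m : ℕ} : Continuous (lastC : Euc m → ℝ) := by
  unfold lastC
  fun_prop

/-- Points of the closure of a local epigraph lie weakly above the graph. -/
theorem le_lastC_of_mem_closure {m : ℕ} {Ω : Set (Euc m)} {r : ℝ}
    {f : EuclideanSpace ℝ (Fin m) → ℝ} (hf : ContinuousOn f (ball 0 r))
    (hgraph : Ω ∩ ball (0 : Euc m) r =
      {y : Euc m | y ∈ ball (0 : Euc m) r ∧ f (front y) < lastC y})
    {x : Euc m} (hx : x ∈ closure Ω) (hxr : x ∈ ball 0 r) : f (front x) ≤ lastC x := by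
  have hcl : x ∈ closure (Ω ∩ ball 0 r) := by
    rw [inter_comm]
    exact isOpen_ball.inter_closure ⟨hxr, hx⟩
  have hcont : ContinuousOn (fun y : Euc m => f (front y)) (ball 0 r) :=
    hf.comp continuous_front.continuousOn fun y hy => front_mem_ball hy
  refine ContinuousWithinAt.closure_le hcl ((hcont x hxr).mono inter_subset_right)
    continuous_lastC.continuousWithinAt fun y hy => ?_
  rw [hgraph] at hy
  exact hy.2.le

/-- A `K`-Lipschitz function fails to be convex along a segment by at most
`2 a b K` times the length of the segment. -/
theorem LipschitzOnWith.le_combo_add {E : Type*} [NormedAddCommGroup E] [NormedSpace ℝ E]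
    {K : ℝ≥0} {f : E → ℝ} {s : Set E} (hf : LipschitzOnWith K f s) (hs : Convex ℝ s)
    {p q : E} (hp : p ∈ s) (hq : q ∈ s) {a b : ℝ} (ha : 0 ≤ a) (hb : 0 ≤ b) (hab : a + b = 1) :
    f (a • p + b • q) ≤ a * f p + b * f q + 2 * a * b * (K * dist p q) := by
  have hz := hs hp hq ha hb hab
  have h1 := hf.dist_le_mul _ hz _ hp
  have h2 := hf.dist_le_mul _ hz _ hq
  have e1 : a • p + b • q - p = b • (q - p) := by
    obtain rfl : a = 1 - b := by linarith
    module
  have e2 : a • p + b • q - q = a • (p - q) := by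
    obtain rfl : b = 1 - a := by linarith
    module
  rw [dist_eq_norm (a • p + b • q), e1, norm_smul, Real.norm_of_nonneg hb, ← dist_eq_norm,
    dist_comm q p, Real.dist_eq] at h1
  rw [dist_eq_norm (a • p + b • q), e2, norm_smul, Real.norm_of_nonneg ha, ← dist_eq_norm,
    Real.dist_eq] at h2
  have h1' := mul_le_mul_of_nonneg_left ((le_abs_self _).trans h1) ha
  have h2' := mul_le_mul_of_nonneg_left ((le_abs_self _).trans h2) hb
  have hfz : f (a • p + b • q) = a * f (a • p + b • q) + b * f (a • p + b • q) := by
    rw [← add_mul, hab, one_mul]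
  linarith

/-- (Star-shapedness, Lemma 2.1.) Suppose `Ω ⊂ ℝ^d` is a domain,
`B = B(0,r)` is centered at `0 ∈ ∂Ω`, and in the fixed (identity) coordinates
`Ω ∩ B = {y ∈ B : y'' > f(y')}` with `f` `τ`-Lipschitz, `f 0 = 0`, and `τ < 1/4`.
If `x₀ ∈ closure Ω ∩ B(0, r/4)` and `x₁ = x₀ + τ r e_d`, then `Ω ∩ B(x₁, r/2)` is
star-shaped with respect to `x₁`. -/
theorem stmt_3 (m : ℕ) (Ω : Set (Euc m)) (hΩ : IsOpen Ω) (hconn : IsConnected Ω)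
    (r : ℝ) (hr : 0 < r) (τ : ℝ≥0) (hτ0 : 0 < τ) (hτ : τ < 1 / 4)
    (h0 : (0 : Euc m) ∈ frontier Ω)
    (f : EuclideanSpace ℝ (Fin m) → ℝ) (hf : LipschitzOnWith τ f (ball 0 r)) (hf0 : f 0 = 0)
    (hgraph : Ω ∩ ball (0 : Euc m) r =
      {y : Euc m | y ∈ ball (0 : Euc m) r ∧ f (front y) < lastC y})
    (x₀ : Euc m) (hx₀ : x₀ ∈ closure Ω ∩ ball (0 : Euc m) (r / 4))
    (x₁ : Euc m) (hx₁ : x₁ = x₀ + ((τ : ℝ) * r) • eLast m)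
    (x₂ : Euc m) (hx₂ : x₂ ∈ Ω ∩ ball x₁ (r / 2)) :
    openSegment ℝ x₁ x₂ ⊆ Ω ∩ ball x₁ (r / 2) := by
  have hτ' : (τ : ℝ) < 1 / 4 := by exact_mod_cast hτ
  have hτpos : (0 : ℝ) < τ := by exact_mod_cast hτ0
  have hx₀n : ‖x₀‖ < r / 4 := mem_ball_zero_iff.mp hx₀.2
  have hfront : front x₁ = front x₀ := by
    rw [hx₁, front_add, front_smul, front_eLast, smul_zero, add_zero]
  have hlast : lastC x₁ = lastC x₀ + τ * r := by
    rw [hx₁, lastC_add, lastC_smul, lastC_eLast, mul_one]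
  have hx₁n : ‖x₁‖ < r / 2 := by
    have h := norm_add_le x₀ (((τ : ℝ) * r) • eLast m)
    rw [← hx₁, norm_smul, eLast, PiLp.norm_single, norm_one, mul_one,
      Real.norm_of_nonneg (by positivity)] at h
    nlinarith
  have hsub : ball x₁ (r / 2) ⊆ ball (0 : Euc m) r :=
    ball_subset_ball' (by rw [dist_zero_right]; linarith)
  have hx₁r : x₁ ∈ ball x₁ (r / 2) := mem_ball_self (by positivity)
  have hx₀f : f (front x₀) ≤ lastC x₀ :=
    le_lastC_of_mem_closure hf.continuousOn hgraph hx₀.1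
      (ball_subset_ball (by linarith) hx₀.2)
  have hx₂f : f (front x₂) < lastC x₂ := (hgraph.subset ⟨hx₂.1, hsub hx₂.2⟩).2
  have hdist : dist (front x₁) (front x₂) < r / 2 := by
    rw [dist_comm, dist_eq_norm, ← front_sub]
    exact (norm_front_le _).trans_lt (mem_ball_iff_norm.mp hx₂.2)
  rintro z ⟨a, b, ha, hb, hab, rfl⟩
  have hz : a • x₁ + b • x₂ ∈ ball x₁ (r / 2) :=
    convex_ball _ _ hx₁r hx₂.2 ha.le hb.le hab
  refine ⟨(hgraph.superset ⟨hsub hz, ?_⟩).1, hz⟩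
  have hcombo := hf.le_combo_add (convex_ball 0 r) (front_mem_ball (hsub hx₁r))
    (front_mem_ball (hsub hx₂.2)) ha.le hb.le hab
  have herr : 2 * a * b * (τ * dist (front x₁) (front x₂)) ≤ a * (τ * r) :=
    calc 2 * a * b * (τ * dist (front x₁) (front x₂))
        ≤ 2 * a * 1 * (τ * (r / 2)) := by gcongr; linarith
      _ = a * (τ * r) := by ring
  rw [front_add, front_smul, front_smul, lastC_add, lastC_smul, lastC_smul]
  have h₁ : a * (f (front x₁) + τ * r) ≤ a * lastC x₁ := by
    rw [hfront, hlast]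
    gcongr
  have h₂ : b * f (front x₂) < b * lastC x₂ := by gcongr
  linarith
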